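/- Let μ > 0 and let (u_μ, v_μ) be the solution of (S2) with u_μ(0) = v_μ(0) = μ, and H_μ(t) = H(t, u_μ(t), v_μ(t)). If v_μ changes sign only a finite number of times on ℝ and H_μ(t) > 0 for all t > 0, then there exist constants C, c > 0 (possibly depending on μ) such that H_μ(t) ≤ C·e^{−c|t|} as t → ±∞. -/

import Mathlib

open Real Filter Set Topology

noncomputable section

/-- System (S2): `u' + ((m-2)/2) u = cosh(t)^{-1/(m-1)} (u²+v²)^{1/(m-1)} v`,
    `-v' + ((m-2)/2) v = cosh(t)^{-1/(m-1)} (u²+v²)^{1/(m-1)} u`. -/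
def IsSolS2 (m : ℕ) (u v : ℝ → ℝ) : Prop :=
  ∀ t : ℝ,
    HasDerivAt u (Real.cosh t ^ (-(1 : ℝ) / ((m : ℝ) - 1))
        * ((u t) ^ 2 + (v t) ^ 2) ^ ((1 : ℝ) / ((m : ℝ) - 1)) * v t
      - (((m : ℝ) - 2) / 2) * u t) t ∧
    HasDerivAt v ((((m : ℝ) - 2) / 2) * v t
      - Real.cosh t ^ (-(1 : ℝ) / ((m : ℝ) - 1))
        * ((u t) ^ 2 + (v t) ^ 2) ^ ((1 : ℝ) / ((m : ℝ) - 1)) * u t) t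

/-- The (time-dependent) energy of (S2). -/
def H2 (m : ℕ) (t u v : ℝ) : ℝ :=
  -(((m : ℝ) - 2) / 2) * u * v
    + (((m : ℝ) - 1) / (2 * (m : ℝ))) * Real.cosh t ^ (-(1 : ℝ) / ((m : ℝ) - 1))
      * (u ^ 2 + v ^ 2) ^ ((m : ℝ) / ((m : ℝ) - 1))

/-- `w` changes sign at least `k` times on `J`. -/
def ChangesSignAtLeast (w : ℝ → ℝ) (J : Set ℝ) (k : ℕ) : Prop :=
  ∃ s : ℕ → ℝ, (∀ i, i ≤ k → s i ∈ J) ∧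
    (∀ i j, i < j → j ≤ k → s i < s j) ∧
    (∀ i, i + 1 ≤ k → w (s i) * w (s (i + 1)) < 0)

/-- `w` changes sign exactly `k` times on `J`. -/
def ChangesSignExactly (w : ℝ → ℝ) (J : Set ℝ) (k : ℕ) : Prop :=
  ChangesSignAtLeast w J k ∧ ¬ ChangesSignAtLeast w J (k + 1)

def SolP (p a : ℝ) (u v : ℝ → ℝ) : Prop :=
  ∀ t : ℝ,
    HasDerivAt u (Real.cosh t ^ (-p) * ((u t) ^ 2 + (v t) ^ 2) ^ p * v t - a * u t) t ∧
    HasDerivAt v (a * v t - Real.cosh t ^ (-p) * ((u t) ^ 2 + (v t) ^ 2) ^ p * u t) t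

lemma SolP.negs {p a : ℝ} {u v : ℝ → ℝ} (h : SolP p a u v) :
    SolP p a (fun t => - u t) (fun t => - v t) := by
  intro t
  refine ⟨(h t).1.neg.congr_deriv ?_, (h t).2.neg.congr_deriv ?_⟩ <;>
  · simp only [neg_sq]; ring

lemma SolP.swap {p a : ℝ} {u v : ℝ → ℝ} (h : SolP p a u v) :
    SolP p a (fun t => v (-t)) (fun t => u (-t)) := by
  intro t
  have h1 : HasDerivAt (fun t => v (-t)) _ t := (h (-t)).2.scomp t (hasDerivAt_neg t)
  have h2 : HasDerivAt (fun t => u (-t)) _ t := (h (-t)).1.scomp t (hasDerivAt_neg t)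
  refine ⟨h1.congr_deriv ?_, h2.congr_deriv ?_⟩ <;>
  · simp only [Real.cosh_neg, smul_eq_mul, add_comm (v (-t) ^ 2)]; ring

/-- Lipschitz estimate for `z ↦ ‖z‖^s z`. -/
lemma lip_aux {s R : ℝ} (hs0 : 0 ≤ s) (hs1 : s ≤ 1) (z w : ℂ) (hz : ‖z‖ ≤ R)
    (hwz : ‖w‖ ≤ ‖z‖) :
    ‖((‖z‖ ^ s : ℝ) : ℂ) * z - ((‖w‖ ^ s : ℝ) : ℂ) * w‖ ≤ 2 * R ^ s * ‖z - w‖ := by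
  have hzR : ‖z‖ ^ s ≤ R ^ s := Real.rpow_le_rpow (norm_nonneg _) hz hs0
  have hws : ‖w‖ ^ s ≤ ‖z‖ ^ s := Real.rpow_le_rpow (norm_nonneg _) hwz hs0
  have key : (‖z‖ ^ s - ‖w‖ ^ s) * ‖w‖ ≤ ‖z‖ ^ s * (‖z‖ - ‖w‖) := by
    rcases (norm_nonneg w).eq_or_lt with h0 | h0
    · rw [← h0]; simp only [mul_zero, sub_zero]; positivity
    · have hz0 : 0 < ‖z‖ := lt_of_lt_of_le h0 hwz
      have h1 : ‖w‖ / ‖z‖ ≤ (‖w‖ / ‖z‖) ^ s := by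
        have := Real.rpow_le_rpow_of_exponent_ge (x := ‖w‖ / ‖z‖) (by positivity)
          ((div_le_one hz0).2 hwz) hs1
        simpa using this
      rw [Real.div_rpow (norm_nonneg _) (norm_nonneg _)] at h1
      have hzs : 0 < ‖z‖ ^ s := by positivity
      rw [div_le_div_iff₀ hz0 hzs] at h1
      have : ‖w‖ * (‖w‖ * ‖z‖ ^ s) ≤ ‖w‖ * (‖w‖ ^ s * ‖z‖) := by gcongr
      have h3 : ((‖z‖ ^ s - ‖w‖ ^ s) * ‖w‖) * ‖z‖ ≤ (‖z‖ ^ s * (‖z‖ - ‖w‖)) * ‖z‖ := by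
        nlinarith [mul_nonneg hzs.le (sq_nonneg (‖z‖ - ‖w‖))]
      exact le_of_mul_le_mul_right h3 hz0
  have e : ((‖z‖ ^ s : ℝ) : ℂ) * z - ((‖w‖ ^ s : ℝ) : ℂ) * w
      = ((‖z‖ ^ s : ℝ) : ℂ) * (z - w) + ((‖z‖ ^ s - ‖w‖ ^ s : ℝ) : ℂ) * w := by
    push_cast; ring
  rw [e]
  refine (norm_add_le _ _).trans ?_
  rw [norm_mul, norm_mul, Complex.norm_real, Complex.norm_real, Real.norm_eq_abs,
    Real.norm_eq_abs, abs_of_nonneg (by positivity : 0 ≤ ‖z‖ ^ s), abs_of_nonneg (by linarith)]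
  have h4 : ‖z‖ - ‖w‖ ≤ ‖z - w‖ := norm_sub_norm_le z w
  have h5 : 0 ≤ ‖z‖ ^ s := by positivity
  have h6 : ‖z‖ ^ s * (‖z‖ - ‖w‖) ≤ ‖z‖ ^ s * ‖z - w‖ := by gcongr
  have h7 : ‖z‖ ^ s * ‖z - w‖ ≤ R ^ s * ‖z - w‖ := by gcongr
  linarith

lemma lip_aux' {s R : ℝ} (hs0 : 0 ≤ s) (hs1 : s ≤ 1) (z w : ℂ) (hz : ‖z‖ ≤ R)
    (hw : ‖w‖ ≤ R) :
    ‖((‖z‖ ^ s : ℝ) : ℂ) * z - ((‖w‖ ^ s : ℝ) : ℂ) * w‖ ≤ 2 * R ^ s * ‖z - w‖ := by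
  rcases le_total ‖w‖ ‖z‖ with h | h
  · exact lip_aux hs0 hs1 z w hz h
  · rw [norm_sub_rev, norm_sub_rev z]; exact lip_aux hs0 hs1 w z hw h

/-- The vector field in complex notation. -/
def VF (p a : ℝ) (t : ℝ) (z : ℂ) : ℂ :=
  -(a : ℂ) * (starRingEnd ℂ) z
    - Complex.I * ((Real.cosh t ^ (-p) : ℝ) : ℂ) * (((‖z‖ ^ (2 * p) : ℝ) : ℂ) * z)

lemma cosh_rpow_le_one {p : ℝ} (hp : 0 ≤ p) (t : ℝ) : Real.cosh t ^ (-p) ≤ 1 :=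
  Real.rpow_le_one_of_one_le_of_nonpos (Real.one_le_cosh t) (by linarith)

lemma VF_lip {p a R : ℝ} (hp : 0 ≤ p) (hp1 : 2 * p ≤ 1) (ha : 0 ≤ a) (hR : 0 ≤ R) (t : ℝ) :
    LipschitzOnWith (Real.toNNReal (a + 2 * R ^ (2 * p))) (VF p a t) (Metric.closedBall 0 R) := by
  apply LipschitzOnWith.of_dist_le_mul
  intro z hz w hw
  rw [mem_closedBall_zero_iff] at hz hw
  rw [dist_eq_norm, dist_eq_norm, Real.coe_toNNReal _ (by positivity)]
  have e : VF p a t z - VF p a t w = -(a : ℂ) * (starRingEnd ℂ) (z - w)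
    - Complex.I * ((Real.cosh t ^ (-p) : ℝ) : ℂ) *
      (((‖z‖ ^ (2 * p) : ℝ) : ℂ) * z - ((‖w‖ ^ (2 * p) : ℝ) : ℂ) * w) := by
    simp only [VF, map_sub]; ring
  rw [e]
  refine (norm_sub_le _ _).trans ?_
  have h0 := lip_aux' (by linarith : 0 ≤ 2 * p) hp1 z w hz hw
  have hc0 : 0 ≤ Real.cosh t ^ (-p) := Real.rpow_nonneg (Real.cosh_pos t).le _
  have hc1 := cosh_rpow_le_one hp t
  simp only [norm_mul, norm_neg, Complex.norm_real, Real.norm_eq_abs, Complex.norm_I,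
    RCLike.norm_conj, abs_of_nonneg ha, abs_of_nonneg hc0, one_mul] at h0 ⊢
  rw [add_mul]
  refine add_le_add le_rfl ?_
  exact (mul_le_of_le_one_left (norm_nonneg _) hc1).trans h0

lemma SolP.toComplex {p a : ℝ} {u v : ℝ → ℝ} (h : SolP p a u v) (t : ℝ) :
    HasDerivAt (fun t => (u t : ℂ) + Complex.I * (v t : ℂ))
      (VF p a t ((u t : ℂ) + Complex.I * (v t : ℂ))) t := by
  have h1 := ((h t).1.ofReal_comp).add (((h t).2.ofReal_comp).const_mul Complex.I)
  refine h1.congr_deriv ?_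
  have hn : ‖(u t : ℂ) + Complex.I * (v t : ℂ)‖ ^ (2 * p) = ((u t) ^ 2 + (v t) ^ 2) ^ p := by
    rw [Real.rpow_mul (norm_nonneg _)]
    congr 1
    rw [Real.rpow_two, Complex.sq_norm, Complex.normSq_apply]
    simp; ring
  rw [VF, hn]
  simp only [map_add, map_mul, Complex.conj_ofReal, Complex.conj_I]
  push_cast
  linear_combination (((Real.cosh t ^ (-p) : ℝ) : ℂ) * ((((u t) ^ 2 + (v t) ^ 2) ^ p : ℝ) : ℂ) * (v t)) * Complex.I_sq

lemma SolP.unique {p a : ℝ} (hp : 0 ≤ p) (hp1 : 2 * p ≤ 1) (ha : 0 ≤ a) {u v u' v' : ℝ → ℝ}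
    (h : SolP p a u v) (h' : SolP p a u' v') (hu : u 0 = u' 0) (hv : v 0 = v' 0)
    (t : ℝ) (ht : 0 ≤ t) : u t = u' t ∧ v t = v' t := by
  set f : ℝ → ℂ := fun t => (u t : ℂ) + Complex.I * (v t : ℂ) with hf
  set g : ℝ → ℂ := fun t => (u' t : ℂ) + Complex.I * (v' t : ℂ) with hg
  have hfd : ∀ s, HasDerivAt f (VF p a s (f s)) s := h.toComplex
  have hgd : ∀ s, HasDerivAt g (VF p a s (g s)) s := h'.toComplex
  have hfc : Continuous f := continuous_iff_continuousAt.2 fun s => (hfd s).continuousAt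
  have hgc : Continuous g := continuous_iff_continuousAt.2 fun s => (hgd s).continuousAt
  obtain ⟨A, hA⟩ := (isCompact_Icc (a := 0) (b := t)).exists_bound_of_continuousOn hfc.continuousOn
  obtain ⟨B, hB⟩ := (isCompact_Icc (a := 0) (b := t)).exists_bound_of_continuousOn hgc.continuousOn
  set R := max A B
  have hR : 0 ≤ R := ((norm_nonneg _).trans (hA 0 ⟨le_rfl, ht⟩)).trans (le_max_left _ _)
  have := ODE_solution_unique_of_mem_Icc_right (v := VF p a) (s := fun _ => Metric.closedBall 0 R)
    (a := 0) (b := t) (f := f) (g := g)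
    (fun s _ => VF_lip hp hp1 ha hR s) hfc.continuousOn (fun s _ => (hfd s).hasDerivWithinAt)
    (fun s hs => mem_closedBall_zero_iff.2 ((hA s ⟨hs.1, hs.2.le⟩).trans (le_max_left _ _)))
    hgc.continuousOn (fun s _ => (hgd s).hasDerivWithinAt)
    (fun s hs => mem_closedBall_zero_iff.2 ((hB s ⟨hs.1, hs.2.le⟩).trans (le_max_right _ _)))
    (by simp [hf, hg, hu, hv]) ⟨ht, le_rfl⟩
  have h1 := congrArg Complex.re this
  have h2 := congrArg Complex.im this
  simp [hf, hg] at h1 h2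
  exact ⟨h1, h2⟩

lemma changes_of_freq {w : ℝ → ℝ} (h1 : ∀ T, ∃ t ≥ T, w t < 0) (h2 : ∀ T, ∃ t ≥ T, 0 < w t)
    (k : ℕ) : ∃ s : ℕ → ℝ, (∀ i j, i < j → j ≤ k → s i < s j) ∧
    (∀ i, i + 1 ≤ k → w (s i) * w (s (i + 1)) < 0) ∧ w (s k) ≠ 0 := by
  induction k with
  | zero =>
    obtain ⟨t, -, ht⟩ := h1 0
    exact ⟨fun _ => t, by intros; omega, by intros; omega, ht.ne⟩
  | succ k ih =>
    obtain ⟨s, hs1, hs2, hs3⟩ := ih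
    have : ∃ t > s k, w (s k) * w t < 0 := by
      rcases hs3.lt_or_gt with h | h
      · obtain ⟨t, ht, ht'⟩ := h2 (s k + 1)
        exact ⟨t, by linarith, mul_neg_of_neg_of_pos h ht'⟩
      · obtain ⟨t, ht, ht'⟩ := h1 (s k + 1)
        exact ⟨t, by linarith, mul_neg_of_pos_of_neg h ht'⟩
    obtain ⟨t, ht, hwt⟩ := this
    refine ⟨fun i => if i ≤ k then s i else t, ?_, ?_, ?_⟩
    · intro i j hij hj
      have hi : i ≤ k := by omega
      simp only [hi, if_true]
      split_ifs with hjk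
      · exact hs1 i j hij hjk
      · rcases hi.eq_or_lt with rfl | hlt
        · exact ht
        · exact (hs1 i k hlt le_rfl).trans ht
    · intro i hi
      have hi' : i ≤ k := by omega
      simp only [hi', if_true]
      split_ifs with hik
      · exact hs2 i hik
      · have : i = k := by omega
        subst this; exact hwt
    · simp only [show ¬ (k + 1 ≤ k) by omega, if_false]
      intro h0; rw [h0] at hwt; simp at hwt

lemma ev_sign {w : ℝ → ℝ} {k : ℕ} (h : ¬ ChangesSignAtLeast w Set.univ k) :
    ∃ T, (∀ t ≥ T, 0 ≤ w t) ∨ (∀ t ≥ T, w t ≤ 0) := by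
  by_contra hc
  push Not at hc
  obtain ⟨s, a, b, -⟩ := changes_of_freq (w := w) (fun T => (hc T).1) (fun T => (hc T).2) k
  exact h ⟨s, fun _ _ => trivial, a, b⟩

lemma changes_neg {w : ℝ → ℝ} {k : ℕ} (h : ChangesSignAtLeast (fun t => w (-t)) Set.univ k) :
    ChangesSignAtLeast w Set.univ k := by
  obtain ⟨s, -, h1, h2⟩ := h
  refine ⟨fun i => - s (k - i), fun _ _ => trivial, ?_, ?_⟩
  · intro i j hij hj
    have := h1 (k - j) (k - i) (by omega) (by omega)
    simpa using this
  · intro i hi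
    have := h2 (k - (i + 1)) (by omega)
    rw [show k - (i + 1) + 1 = k - i by omega] at this
    rw [mul_comm]; exact this

lemma no_opposite {p a : ℝ} (hp : 0 < p) (ha : 1 ≤ 2 * a) {u v : ℝ → ℝ} (h : SolP p a u v)
    (hr : ∀ t > 0, 0 < u t ^ 2 + v t ^ 2) (T : ℝ) (hv : ∀ t ≥ T, 0 ≤ v t)
    (hu : ∀ t ≥ T, u t ≤ 0) : False := by
  have hcp : ∀ t, 0 < Real.cosh t ^ (-p) := fun t => Real.rpow_pos_of_pos (Real.cosh_pos t) _
  -- a point with v positive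
  have hex : ∃ t0, T ≤ t0 ∧ 0 < t0 ∧ 0 < v t0 := by
    by_contra hc
    push Not at hc
    set t1 := max T 0 + 1
    have hT1 : T < t1 := by have := le_max_left T 0; simp only [t1]; linarith
    have h01 : 0 < t1 := by have := le_max_right T 0; simp only [t1]; linarith
    have hv0 : ∀ t, T ≤ t → 0 < t → v t = 0 := fun t a b => le_antisymm (hc t a b) (hv t a)
    have hev : v =ᶠ[𝓝 t1] fun _ => 0 := by
      filter_upwards [lt_mem_nhds hT1, lt_mem_nhds h01] with t a b using hv0 t a.le b
    have hd := (h t1).2.unique ((hasDerivAt_const t1 (0 : ℝ)).congr_of_eventuallyEq hev)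
    have hrt := hr t1 h01
    have hvt := hv0 t1 hT1.le h01
    have : u t1 ≠ 0 := by rintro h0; rw [h0, hvt] at hrt; simp at hrt
    rw [hvt] at hd hrt
    have hx : 0 < (u t1 ^ 2 + 0 ^ 2) ^ p := Real.rpow_pos_of_pos hrt _
    have := mul_ne_zero (mul_ne_zero (hcp t1).ne' hx.ne') this
    apply this; linarith
  obtain ⟨t0, hTt, ht0, hvt0⟩ := hex
  -- exponential growth of v
  have hgrow : ∀ t ≥ t0, v t0 * Real.exp (a * (t - t0)) ≤ v t := by
    have hd : ∀ t, HasDerivAt (fun t => v t * Real.exp (-a * t)) _ t := fun t =>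
      (h t).2.mul (((hasDerivAt_id t).const_mul (-a)).exp)
    have hm : MonotoneOn (fun t => v t * Real.exp (-a * t)) (Ici t0) := by
      apply monotoneOn_of_deriv_nonneg (convex_Ici t0)
      · exact fun t _ => (hd t).continuousAt.continuousWithinAt
      · exact fun t _ => (hd t).differentiableAt.differentiableWithinAt
      · intro t ht
        rw [interior_Ici] at ht
        rw [(hd t).deriv]
        have hut := hu t (hTt.trans (le_of_lt ht))
        have hx : 0 ≤ (u t ^ 2 + v t ^ 2) ^ p := by positivity
        have : 0 ≤ Real.cosh t ^ (-p) * (u t ^ 2 + v t ^ 2) ^ p * (-u t) :=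
          mul_nonneg (mul_nonneg (hcp t).le hx) (by linarith)
        have := mul_nonneg this (Real.exp_pos (-a * t)).le
        simp only [id]
        nlinarith
    intro t ht
    have h1 := hm (mem_Ici.2 le_rfl) (mem_Ici.2 ht) ht
    simp only at h1
    have h2 := mul_le_mul_of_nonneg_right h1 (Real.exp_pos (a * t)).le
    rw [mul_assoc, mul_assoc, ← Real.exp_add, ← Real.exp_add,
      show -a * t0 + a * t = a * (t - t0) by ring, show -a * t + a * t = 0 by ring] at h2
    simpa using h2
  set δ : ℝ := Real.exp (-p * t0) * (v t0 ^ 2) ^ p * v t0 with hδ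
  have hδ0 : 0 < δ := by positivity
  have hder : ∀ t ≥ t0, δ ≤ Real.cosh t ^ (-p) * ((u t) ^ 2 + (v t) ^ 2) ^ p * v t - a * u t := by
    intro t ht
    have hut := hu t (hTt.trans ht)
    have hg := hgrow t ht
    have hc : Real.exp (-p * t) ≤ Real.cosh t ^ (-p) := by
      rw [show -p * t = t * (-p) by ring, Real.exp_mul]
      apply Real.rpow_le_rpow_of_nonpos (Real.cosh_pos t) _ (by linarith)
      rw [Real.cosh_eq]
      have : Real.exp (-t) ≤ Real.exp t := Real.exp_le_exp.2 (by linarith)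
      linarith
    have he1 : 1 ≤ Real.exp (a * (t - t0)) :=
      Real.one_le_exp (mul_nonneg (by linarith) (by linarith))
    have hvv : v t0 ≤ v t := by nlinarith
    have hpow : (v t0 ^ 2) ^ p * Real.exp (p * (t - t0)) ≤ ((u t) ^ 2 + (v t) ^ 2) ^ p := by
      rw [show p * (t - t0) = (t - t0) * p by ring, Real.exp_mul,
        ← Real.mul_rpow (by positivity) (by positivity)]
      apply Real.rpow_le_rpow (by positivity) _ hp.le
      have h1 : Real.exp (t - t0) ≤ Real.exp (a * (t - t0)) ^ 2 := by
        rw [← Real.exp_nat_mul]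
        apply Real.exp_le_exp.2
        push_cast
        nlinarith
      calc v t0 ^ 2 * Real.exp (t - t0) ≤ v t0 ^ 2 * Real.exp (a * (t - t0)) ^ 2 := by gcongr
        _ = (v t0 * Real.exp (a * (t - t0))) ^ 2 := by ring
        _ ≤ v t ^ 2 := by gcongr
        _ ≤ _ := by nlinarith [sq_nonneg (u t)]
    have h3 : δ ≤ Real.cosh t ^ (-p) * ((u t) ^ 2 + (v t) ^ 2) ^ p * v t := by
      have : δ = Real.exp (-p * t) * ((v t0 ^ 2) ^ p * Real.exp (p * (t - t0))) * v t0 := by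
        rw [hδ, show -p * t0 = -p * t + p * (t - t0) by ring, Real.exp_add]; ring
      rw [this]
      gcongr
    nlinarith
  have hm : MonotoneOn (fun t => u t - δ * t) (Ici t0) := by
    have hd : ∀ t, HasDerivAt (fun t => u t - δ * t) _ t := fun t =>
      (h t).1.sub ((hasDerivAt_id t).const_mul δ)
    apply monotoneOn_of_deriv_nonneg (convex_Ici t0)
    · exact fun t _ => (hd t).continuousAt.continuousWithinAt
    · exact fun t _ => (hd t).differentiableAt.differentiableWithinAt
    · intro t ht
      rw [interior_Ici] at ht
      rw [(hd t).deriv]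
      have := hder t (le_of_lt ht)
      linarith
  have hu0 := hu t0 hTt
  set t2 := t0 + (-u t0 + 1) / δ with ht2
  have hle : t0 ≤ t2 := by
    have : 0 ≤ (-u t0 + 1) / δ := div_nonneg (by linarith) hδ0.le
    linarith
  have h1 := hm (mem_Ici.2 le_rfl) (mem_Ici.2 hle) hle
  simp only at h1
  have h2 : δ * t2 = δ * t0 + (-u t0 + 1) := by rw [ht2]; field_simp
  have h3 := hu t2 (hTt.trans hle)
  linarith

def HP (p a t u v : ℝ) : ℝ :=
  -a * u * v + 1 / (2 * (1 + p)) * Real.cosh t ^ (-p) * (u ^ 2 + v ^ 2) ^ (1 + p)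

lemma HP_deriv {p a : ℝ} (hp : 0 < p) {u v : ℝ → ℝ} (h : SolP p a u v) (t : ℝ) :
    HasDerivAt (fun t => HP p a t (u t) (v t))
      (-p * (Real.sinh t / Real.cosh t) *
        (1 / (2 * (1 + p)) * Real.cosh t ^ (-p) * (u t ^ 2 + v t ^ 2) ^ (1 + p))) t := by
  have hu := (h t).1
  have hv := (h t).2
  have hc := (Real.hasDerivAt_cosh t).rpow_const (p := -p) (Or.inl (Real.cosh_pos t).ne')
  have hr := ((hu.pow 2).add (hv.pow 2)).rpow_const (p := 1 + p) (Or.inr (by linarith))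
  have := ((hu.const_mul (-a)).mul hv).add ((hc.const_mul (1 / (2 * (1 + p)))).mul hr)
  refine this.congr_deriv ?_
  have e1 : Real.cosh t ^ (-p - 1) = Real.cosh t ^ (-p) / Real.cosh t :=
    Real.rpow_sub_one (Real.cosh_pos t).ne' _
  simp only [Pi.add_apply, Pi.pow_apply, add_sub_cancel_left]
  rw [e1]
  have := (Real.cosh_pos t).ne'
  generalize Real.cosh t ^ (-p) = g
  generalize (u t ^ 2 + v t ^ 2) ^ p = r
  generalize (u t ^ 2 + v t ^ 2) ^ (1 + p) = r'
  field_simp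
  push_cast
  ring

lemma HP_decay {p a : ℝ} (hp : 0 < p) (ha : 0 ≤ a) {u v : ℝ → ℝ} (h : SolP p a u v)
    (T : ℝ) (hT : 1 ≤ T) (huv : ∀ t ≥ T, 0 ≤ u t * v t) (t : ℝ) (ht : T ≤ t) :
    HP p a t (u t) (v t) ≤
      (HP p a T (u T) (v T) * Real.exp (p / 2 * T)) * Real.exp (-(p / 2) * t) := by
  have hd : ∀ t, HasDerivAt (fun t => HP p a t (u t) (v t) * Real.exp (p / 2 * t)) _ t := fun t =>
      (HP_deriv hp h t).mul (((hasDerivAt_id t).const_mul (p / 2)).exp)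
  have hm : AntitoneOn (fun t => HP p a t (u t) (v t) * Real.exp (p / 2 * t)) (Ici T) := by
    apply antitoneOn_of_deriv_nonpos (convex_Ici T)
    · exact fun t _ => (hd t).continuousAt.continuousWithinAt
    · exact fun t _ => (hd t).differentiableAt.differentiableWithinAt
    · intro t ht
      rw [interior_Ici] at ht
      have htT : T ≤ t := le_of_lt ht
      rw [(hd t).deriv]
      have huvt := huv t htT
      set K := 1 / (2 * (1 + p)) * Real.cosh t ^ (-p) * (u t ^ 2 + v t ^ 2) ^ (1 + p) with hK
      have hK0 : 0 ≤ K := by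
        have := Real.rpow_nonneg (Real.cosh_pos t).le (-p)
        positivity
      have hHK : HP p a t (u t) (v t) ≤ K := by
        rw [HP, ← hK]; nlinarith [mul_nonneg ha huvt]
      have hth : 1 / 2 ≤ Real.sinh t / Real.cosh t := by
        rw [div_le_div_iff₀ (by norm_num) (Real.cosh_pos t), Real.sinh_eq, Real.cosh_eq]
        have h1 := Real.add_one_le_exp t
        have h2 : Real.exp t * Real.exp (-t) = 1 := by rw [← Real.exp_add]; simp
        have h3 := Real.exp_pos (-t)
        have : 2 * Real.exp (-t) ≤ 1 := by nlinarith
        nlinarith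
      have h4 : p * (1 / 2) * K ≤ p * (Real.sinh t / Real.cosh t) * K := by gcongr
      have h5 : p / 2 * HP p a t (u t) (v t) ≤ p / 2 * K := by gcongr
      have h6 := Real.exp_pos (p / 2 * t)
      simp only [id]
      have h7 : -p * (Real.sinh t / Real.cosh t) * K + p / 2 * HP p a t (u t) (v t) ≤ 0 := by
        linarith
      have := mul_nonpos_of_nonpos_of_nonneg h7 h6.le
      linarith
  have h1 := hm (mem_Ici.2 le_rfl) (mem_Ici.2 ht) ht
  simp only at h1
  have h2 := mul_le_mul_of_nonneg_right h1 (Real.exp_pos (-(p / 2) * t)).le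
  rw [mul_assoc (HP p a t (u t) (v t)), ← Real.exp_add] at h2
  simpa using h2

theorem stmt15 (m : ℕ) (hm : 3 ≤ m) (μ : ℝ) (hμ : 0 < μ)
    (u v : ℝ → ℝ) (hsol : IsSolS2 m u v) (hu0 : u 0 = μ) (hv0 : v 0 = μ)
    (hfin : ∃ k : ℕ, ¬ ChangesSignAtLeast v Set.univ k)
    (hpos : ∀ t : ℝ, 0 < t → 0 < H2 m t (u t) (v t)) :
    ∃ C c T : ℝ, 0 < C ∧ 0 < c ∧ 0 < T ∧
      ∀ t : ℝ, T ≤ |t| → H2 m t (u t) (v t) ≤ C * Real.exp (-c * |t|) := by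
  have hm3 : (3 : ℝ) ≤ m := by exact_mod_cast hm
  have hm1 : (0 : ℝ) < m - 1 := by linarith
  obtain ⟨p, hp⟩ : ∃ p : ℝ, p = 1 / ((m : ℝ) - 1) := ⟨_, rfl⟩
  obtain ⟨a, ha⟩ : ∃ a : ℝ, a = ((m : ℝ) - 2) / 2 := ⟨_, rfl⟩
  have hp0 : 0 < p := by rw [hp]; positivity
  have hp1 : 2 * p ≤ 1 := by
    rw [hp, mul_one_div, div_le_one hm1]; linarith
  have ha1 : 1 ≤ 2 * a := by rw [ha]; linarith
  have hnp : -(1 : ℝ) / ((m : ℝ) - 1) = -p := by rw [hp]; ring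
  have h1p : (m : ℝ) / ((m : ℝ) - 1) = 1 + p := by rw [hp]; field_simp; ring
  have hco : ((m : ℝ) - 1) / (2 * (m : ℝ)) = 1 / (2 * (1 + p)) := by
    rw [← h1p]; field_simp
  have hH : ∀ t x y, H2 m t x y = HP p a t x y := by
    intro t x y
    rw [H2, HP, hnp, h1p, hco, ha]
  have hs : SolP p a u v := by
    intro t
    have := hsol t
    rw [hnp, ← hp, ← ha] at this
    exact this
  simp only [hH] at hpos ⊢
  have hsym : ∀ t ≥ 0, u t = v (-t) ∧ v t = u (-t) :=
    SolP.unique hp0.le hp1 (by linarith) hs hs.swap (by simp [hu0, hv0]) (by simp [hu0, hv0])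
  have hr : ∀ t > 0, 0 < u t ^ 2 + v t ^ 2 := by
    intro t ht
    by_contra hc
    have h1 : u t = 0 := by nlinarith [sq_nonneg (u t), sq_nonneg (v t)]
    have h2 : v t = 0 := by nlinarith [sq_nonneg (u t), sq_nonneg (v t)]
    have := hpos t ht
    rw [HP, h1, h2] at this
    simp [Real.zero_rpow (by linarith : 1 + p ≠ 0)] at this
  obtain ⟨k, hk⟩ := hfin
  obtain ⟨T1, hT1⟩ := ev_sign hk
  obtain ⟨T2, hT2⟩ := ev_sign (w := fun t => v (-t)) (k := k) (fun h => hk (changes_neg h))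
  set T := max 1 (max T1 T2) with hT
  have hT0 : 1 ≤ T := le_max_left _ _
  have hTT1 : T1 ≤ T := (le_max_left _ _).trans (le_max_right _ _)
  have hTT2 : T2 ≤ T := (le_max_right _ _).trans (le_max_right _ _)
  have hu' : (∀ t ≥ T, 0 ≤ u t) ∨ (∀ t ≥ T, u t ≤ 0) := by
    refine hT2.imp (fun h t ht => ?_) (fun h t ht => ?_) <;>
    · rw [(hsym t (by linarith)).1]; exact h t (hTT2.trans ht)
  have hv' : (∀ t ≥ T, 0 ≤ v t) ∨ (∀ t ≥ T, v t ≤ 0) :=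
    hT1.imp (fun h t ht => h t (hTT1.trans ht)) (fun h t ht => h t (hTT1.trans ht))
  have huv : ∀ t ≥ T, 0 ≤ u t * v t := by
    rcases hu' with h1 | h1 <;> rcases hv' with h2 | h2
    · exact fun t ht => mul_nonneg (h1 t ht) (h2 t ht)
    · exact (no_opposite hp0 ha1 hs.negs (by simpa using hr) T
        (fun t ht => by simpa using h2 t ht) (fun t ht => by simpa using h1 t ht)).elim
    · exact (no_opposite hp0 ha1 hs hr T h2 h1).elim
    · exact fun t ht => mul_nonneg_of_nonpos_of_nonpos (h1 t ht) (h2 t ht)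
  have hdec := HP_decay hp0 (by linarith) hs T hT0 huv
  refine ⟨HP p a T (u T) (v T) * Real.exp (p / 2 * T), p / 2, T,
    mul_pos (hpos T (by linarith)) (Real.exp_pos _), by positivity, by linarith, ?_⟩
  intro t ht
  rcases le_total 0 t with h0 | h0
  · rw [abs_of_nonneg h0] at ht ⊢
    exact hdec t ht
  · rw [abs_of_nonpos h0] at ht ⊢
    have h1 := hdec (-t) ht
    have h2 := hsym (-t) (by linarith)
    rw [neg_neg] at h2
    rw [h2.1, h2.2] at h1
    refine le_trans (le_of_eq ?_) h1
    rw [HP, HP, Real.cosh_neg, add_comm (u t ^ 2)]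
    ring
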